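/- Let h be a continuous complex-valued function on the circle all of whose negative Fourier coefficients vanish. Then h is the boundary value of a holomorphic function on the unit disk: there exists F : ℂ → ℂ which is continuous on the closed unit ball, complex-differentiable on the open unit ball, and satisfies F(exp(i t)) = h(t) for all t. (The paper states this for piecewise smooth h; this continuous version is the honest general statement.) -/

import Mathlib

open Real

noncomputable instance : Fact (0 < 2 * Real.pi) := ⟨by positivity⟩

/-- Fejér means, written as a double sum. -/
noncomputable def fejerMean (N : ℕ) (f : C(AddCircle (2 * Real.pi), ℂ)) :
    C(AddCircle (2 * Real.pi), ℂ) :=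
  (N : ℂ)⁻¹ • ∑ j ∈ Finset.Ico (0 : ℤ) N, ∑ k ∈ Finset.Ico (0 : ℤ) N,
    fourierCoeff f (j - k) • fourier (j - k)

section helpers
open Filter Topology MeasureTheory AddCircle

lemma integrable_circle (f : C(AddCircle (2 * Real.pi), ℂ)) :
    Integrable f (haarAddCircle (T := 2 * Real.pi)) :=
  f.continuous.integrable_of_hasCompactSupport (HasCompactSupport.of_compactSpace _)

lemma fejerMean_add (N : ℕ) (f g : C(AddCircle (2 * Real.pi), ℂ)) :
    fejerMean N (f + g) = fejerMean N f + fejerMean N g := by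
  have : ∀ n, fourierCoeff (⇑(f + g)) n = fourierCoeff f n + fourierCoeff g n := by
    intro n
    rw [ContinuousMap.coe_add, fourierCoeff.add (integrable_circle f) (integrable_circle g)]
    rfl
  simp only [fejerMean, this, add_smul, Finset.sum_add_distrib, smul_add]

lemma fejerMean_smul (N : ℕ) (c : ℂ) (f : C(AddCircle (2 * Real.pi), ℂ)) :
    fejerMean N (c • f) = c • fejerMean N f := by
  have : ∀ n, fourierCoeff (⇑(c • f)) n = c * fourierCoeff f n := by
    intro n
    rw [ContinuousMap.coe_smul, fourierCoeff.const_smul, smul_eq_mul]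
  simp only [fejerMean, this, mul_smul, ← Finset.smul_sum]
  rw [smul_comm]

lemma fejerMean_fourier (N : ℕ) (n : ℤ) (hn : |n| ≤ N) :
    fejerMean N (fourier n) = ((N : ℂ)⁻¹ * (N - |n| : ℤ)) • fourier n := by
  have h1 : ∀ j ∈ Finset.Ico (0 : ℤ) N, (∑ k ∈ Finset.Ico (0 : ℤ) N,
      fourierCoeff (fourier n : C(AddCircle (2 * Real.pi), ℂ)) (j - k) • fourier (T := 2 * Real.pi) (j - k))
      = if j - n ∈ Finset.Ico (0 : ℤ) N then fourier n else 0 := by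
    intro j _
    rw [← Finset.sum_ite_eq' (Finset.Ico (0 : ℤ) N) (j - n) (fun _ => fourier (T := 2 * Real.pi) n)]
    refine Finset.sum_congr rfl fun k _ => ?_
    rw [fourierCoeff_fourier]
    by_cases hk : k = j - n
    · subst hk; simp
    · rw [if_neg hk, Pi.single_apply, if_neg (by omega), zero_smul]
  rw [fejerMean, Finset.sum_congr rfl h1, ← Finset.sum_filter, Finset.sum_const, mul_smul]
  congr 1
  have : (Finset.Ico (0 : ℤ) N).filter (fun j => j - n ∈ Finset.Ico (0 : ℤ) N)
      = Finset.Ico (max 0 n) (min (N : ℤ) (N + n)) := by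
    ext j; simp only [Finset.mem_filter, Finset.mem_Ico]; omega
  rw [this, Int.card_Ico, ← Nat.cast_smul_eq_nsmul ℂ]
  congr 1
  have h2 : (((min (N : ℤ) (N + n) - max 0 n).toNat : ℕ) : ℤ) = N - |n| := by
    rw [Int.abs_eq_natAbs] at *
    omega
  exact_mod_cast congrArg (Int.cast : ℤ → ℂ) h2

lemma integrable_fourier_mul (f : C(AddCircle (2 * Real.pi), ℂ)) (n : ℤ) :
    Integrable (fun t => fourier n t * f t) (haarAddCircle (T := 2 * Real.pi)) := by
  have hc : Continuous (fun t => fourier n t * f t) :=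
    (ContinuousMap.continuous _).mul f.continuous
  exact integrable_circle ⟨_, hc⟩

lemma integral_sum_sum_aux {X : Type*} [MeasurableSpace X] {μ : Measure X} (s : Finset ℤ)
    (g : ℤ → ℤ → X → ℂ) (hg : ∀ j k, Integrable (g j k) μ) :
    ∫ t, ∑ j ∈ s, ∑ k ∈ s, g j k t ∂μ = ∑ j ∈ s, ∑ k ∈ s, ∫ t, g j k t ∂μ := by
  rw [integral_finsetSum _ fun j _ => integrable_finsetSum _ fun k _ => hg j k]
  exact Finset.sum_congr rfl fun j _ => integral_finsetSum _ fun k _ => hg j k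

lemma fejerMean_apply (N : ℕ) (f : C(AddCircle (2 * Real.pi), ℂ)) (x : AddCircle (2 * Real.pi)) :
    fejerMean N f x = ∫ t, f t *
      (((N : ℝ)⁻¹ * ‖∑ j ∈ Finset.Ico (0 : ℤ) N, fourier j (x - t)‖ ^ 2 : ℝ) : ℂ)
        ∂(haarAddCircle (T := 2 * Real.pi)) := by
  have key : ∀ t, f t *
      (((N : ℝ)⁻¹ * ‖∑ j ∈ Finset.Ico (0 : ℤ) N, fourier j (x - t)‖ ^ 2 : ℝ) : ℂ)
      = (N : ℂ)⁻¹ * ∑ j ∈ Finset.Ico (0 : ℤ) N, ∑ k ∈ Finset.Ico (0 : ℤ) N,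
        (fourier (-(j - k)) t * f t) * fourier (j - k) x := by
    intro t
    have : ((‖∑ j ∈ Finset.Ico (0 : ℤ) N, fourier j (x - t)‖ ^ 2 : ℝ) : ℂ)
        = ∑ j ∈ Finset.Ico (0 : ℤ) N, ∑ k ∈ Finset.Ico (0 : ℤ) N,
          fourier (-(j - k)) t * fourier (j - k) x := by
      rw [Complex.ofReal_pow, ← Complex.mul_conj', map_sum, Finset.sum_mul_sum]
      refine Finset.sum_congr rfl fun j _ => Finset.sum_congr rfl fun k _ => ?_
      rw [← fourier_neg, ← fourier_add]
      simp only [fourier_apply]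
      rw [← Circle.coe_mul, ← AddCircle.toCircle_add]
      congr 2
      module
    rw [Complex.ofReal_mul, this, Complex.ofReal_inv, Complex.ofReal_natCast, mul_left_comm,
      Finset.mul_sum]
    congr 1
    refine Finset.sum_congr rfl fun j _ => ?_
    rw [Finset.mul_sum]
    refine Finset.sum_congr rfl fun k _ => ?_
    ring
  simp_rw [key]
  have hInt : ∀ j k : ℤ, Integrable (fun t => (fourier (-(j - k)) t * f t) * fourier (j - k) x)
      (haarAddCircle (T := 2 * Real.pi)) := by
    intro j k
    have h1 := integrable_fourier_mul f (-(j - k))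
    exact h1.mul_const (fourier (j - k) x)
  rw [integral_const_mul, integral_sum_sum_aux _ _ hInt]
  simp_rw [integral_mul_const]
  simp [fejerMean, fourierCoeff]

lemma fejerMean_norm_le (N : ℕ) (f : C(AddCircle (2 * Real.pi), ℂ)) :
    ‖fejerMean N f‖ ≤ ‖f‖ := by
  rcases Nat.eq_zero_or_pos N with rfl | hN
  · simp [fejerMean]
  rw [ContinuousMap.norm_le _ (norm_nonneg _)]
  intro x
  set K : AddCircle (2 * Real.pi) → ℝ := fun t =>
    (N : ℝ)⁻¹ * ‖∑ j ∈ Finset.Ico (0 : ℤ) N, fourier j (x - t)‖ ^ 2 with hK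
  have hK0 : ∀ t, 0 ≤ K t := fun t => by positivity
  have hKc : Continuous K := by rw [hK]; fun_prop
  have hKi : ∫ t, K t ∂(haarAddCircle (T := 2 * Real.pi)) = 1 := by
    have h1 := fejerMean_apply N (fourier 0) x
    rw [fejerMean_fourier N 0 (by simp)] at h1
    simp only [fourier_zero, one_mul, ContinuousMap.smul_apply] at h1
    rw [integral_complex_ofReal] at h1
    have : (N : ℂ) ≠ 0 := by exact_mod_cast hN.ne'
    simp [this] at h1
    rw [hK]
    exact_mod_cast h1.symm
  rw [fejerMean_apply]
  calc _ ≤ ∫ t, ‖f‖ * K t ∂(haarAddCircle (T := 2 * Real.pi)) := by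
        apply norm_integral_le_of_norm_le
        · exact (hKc.integrable_of_hasCompactSupport
            (HasCompactSupport.of_compactSpace _)).const_mul _
        · refine Eventually.of_forall fun t => ?_
          rw [norm_mul, Complex.norm_real, Real.norm_of_nonneg (hK0 t)]
          exact mul_le_mul_of_nonneg_right (f.norm_coe_le_norm t) (hK0 t)
    _ = ‖f‖ := by rw [integral_const_mul, hKi, mul_one]

lemma fejerMean_tendsto (f : C(AddCircle (2 * Real.pi), ℂ)) :
    Tendsto (fun N => fejerMean N f) atTop (𝓝 f) := by
  have hspan : ∀ q ∈ Submodule.span ℂ (Set.range (@fourier (2 * Real.pi))),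
      Tendsto (fun N => fejerMean N q) atTop (𝓝 q) := by
    intro q hq
    induction hq using Submodule.span_induction with
    | mem q hq =>
      obtain ⟨n, rfl⟩ := hq
      have h1 : Tendsto (fun N : ℕ => (1 : ℂ) - (|n| : ℤ) * (N : ℂ)⁻¹) atTop (𝓝 1) := by
        have := (tendsto_inv_atTop_nhds_zero_nat (𝕜 := ℂ)).const_mul ((|n| : ℤ) : ℂ)
        simpa using this.const_sub 1
      have h2 := h1.smul_const (fourier (T := 2 * Real.pi) n)
      rw [one_smul] at h2
      refine h2.congr' ?_
      filter_upwards [eventually_ge_atTop (n.natAbs + 1)] with N hN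
      rw [fejerMean_fourier N n (by rw [Int.abs_eq_natAbs]; omega)]
      have : (N : ℂ) ≠ 0 := by
        have : N ≠ 0 := by omega
        exact_mod_cast this
      congr 1
      rw [Int.cast_sub, Int.cast_natCast]
      field_simp
    | zero =>
      have : ∀ N, fejerMean N 0 = 0 := fun N => by
        simpa using fejerMean_smul N 0 0
      simp [this]
    | add x y _ _ hx hy => simp only [fejerMean_add]; exact hx.add hy
    | smul c x _ hx => simp only [fejerMean_smul]; exact hx.const_smul c
  have hf : f ∈ closure (Submodule.span ℂ (Set.range (@fourier (2 * Real.pi))) : Set _) := by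
    rw [← Submodule.topologicalClosure_coe, span_fourier_closure_eq_top]; trivial
  rw [Metric.tendsto_atTop]
  intro ε hε
  obtain ⟨q, hq, hfq⟩ := Metric.mem_closure_iff.1 hf (ε / 3) (by positivity)
  obtain ⟨M, hM⟩ := Metric.tendsto_atTop.1 (hspan q hq) (ε / 3) (by positivity)
  refine ⟨M, fun N hN => ?_⟩
  have h1 : dist (fejerMean N f) (fejerMean N q) ≤ dist f q := by
    rw [dist_eq_norm, dist_eq_norm]
    have : fejerMean N f = fejerMean N (f - q) + fejerMean N q := by
      rw [← fejerMean_add, sub_add_cancel]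
    rw [this, add_sub_cancel_right]
    exact fejerMean_norm_le N _
  have h2 := dist_triangle4 (fejerMean N f) (fejerMean N q) q f
  have h3 := hM N hN
  rw [dist_comm q f] at h2
  linarith

end helpers

/-- A continuous function on the circle all of whose negative Fourier
coefficients vanish is the boundary value of a holomorphic function on the unit disk. -/
theorem boundary_value_of_holomorphic_of_fourierCoeff_neg_eq_zero
    (h : AddCircle (2 * Real.pi) → ℂ) (hcont : Continuous h)
    (hneg : ∀ n : ℤ, n < 0 → fourierCoeff h n = 0) :
    ∃ F : ℂ → ℂ,
      ContinuousOn F (Metric.closedBall (0 : ℂ) 1) ∧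
      DifferentiableOn ℂ F (Metric.ball (0 : ℂ) 1) ∧
      ∀ t : ℝ, F (Complex.exp (Complex.I * t)) = h t := by
  set f : C(AddCircle (2 * Real.pi), ℂ) := ⟨h, hcont⟩ with hf
  have hfl := fejerMean_tendsto f
  set p : ℕ → ℂ → ℂ := fun N z =>
    (N : ℂ)⁻¹ * ∑ j ∈ Finset.Ico (0 : ℤ) N, ∑ k ∈ Finset.Ico (0 : ℤ) N,
      fourierCoeff f (j - k) * z ^ (j - k).toNat with hp
  have hpd : ∀ N, Differentiable ℂ (p N) := fun N => by rw [hp]; fun_prop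
  have hpb : ∀ N (t : ℝ), p N (Complex.exp (Complex.I * t)) = fejerMean N f t := by
    intro N t
    simp only [hp, fejerMean, ContinuousMap.smul_apply, ContinuousMap.sum_apply, smul_eq_mul]
    congr 1
    refine Finset.sum_congr rfl fun j _ => Finset.sum_congr rfl fun k _ => ?_
    rcases lt_or_ge (j - k) 0 with hlt | hge
    · have : fourierCoeff f (j - k) = 0 := hneg _ hlt
      rw [this, zero_mul, zero_mul]
    · obtain ⟨n, hn⟩ := Int.eq_ofNat_of_zero_le hge
      rw [hn, Int.toNat_natCast, fourier_coe_apply, ← Complex.exp_nat_mul]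
      congr 2
      have : (Real.pi : ℂ) ≠ 0 := by exact_mod_cast Real.pi_ne_zero
      push_cast
      field_simp
  have hcircle : ∀ z ∈ frontier (Metric.ball (0 : ℂ) 1),
      ∃ t : ℝ, z = Complex.exp (Complex.I * t) := by
    intro z hz
    rw [frontier_ball _ one_ne_zero, mem_sphere_zero_iff_norm] at hz
    refine ⟨z.arg, ?_⟩
    have := Complex.norm_mul_exp_arg_mul_I z
    rw [hz, Complex.ofReal_one, one_mul] at this
    rw [mul_comm, this]
  have hmax : ∀ m n, ∀ z ∈ Metric.closedBall (0 : ℂ) 1,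
      dist (p m z) (p n z) ≤ dist (fejerMean m f) (fejerMean n f) := by
    intro m n z hz
    rw [← closure_ball _ one_ne_zero] at hz
    rw [dist_eq_norm]
    refine Complex.norm_le_of_forall_mem_frontier_norm_le (f := fun z => p m z - p n z)
      Metric.isBounded_ball ((hpd m).sub (hpd n)).diffContOnCl ?_ hz
    intro w hw
    obtain ⟨t, rfl⟩ := hcircle w hw
    simp only [hpb]
    rw [← dist_eq_norm]
    exact ContinuousMap.dist_apply_le_dist _
  have hUC : UniformCauchySeqOn p Filter.atTop (Metric.closedBall (0 : ℂ) 1) := by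
    rw [Metric.uniformCauchySeqOn_iff]
    intro ε hε
    obtain ⟨M, hM⟩ := Metric.cauchySeq_iff.1 hfl.cauchySeq ε hε
    exact ⟨M, fun m hm n hn z hz => (hmax m n z hz).trans_lt (hM m hm n hn)⟩
  have hlim : ∀ z, ∃ w, z ∈ Metric.closedBall (0 : ℂ) 1 →
      Filter.Tendsto (fun N => p N z) Filter.atTop (nhds w) := by
    intro z
    by_cases hz : z ∈ Metric.closedBall (0 : ℂ) 1
    · obtain ⟨w, hw⟩ := cauchySeq_tendsto_of_complete (hUC.cauchySeq hz)
      exact ⟨w, fun _ => hw⟩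
    · exact ⟨0, fun h => absurd h hz⟩
  choose F hF using hlim
  have hU : TendstoUniformlyOn p F Filter.atTop (Metric.closedBall (0 : ℂ) 1) :=
    hUC.tendstoUniformlyOn_of_tendsto hF
  refine ⟨F, hU.continuousOn (Filter.Frequently.of_forall fun N => (hpd N).continuous.continuousOn), ?_, ?_⟩
  · exact (hU.mono Metric.ball_subset_closedBall).tendstoLocallyUniformlyOn.differentiableOn
      (Filter.Eventually.of_forall fun N => (hpd N).differentiableOn) Metric.isOpen_ball
  · intro t
    have hz : Complex.exp (Complex.I * t) ∈ Metric.closedBall (0 : ℂ) 1 := by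
      rw [mem_closedBall_zero_iff, mul_comm, Complex.norm_exp_ofReal_mul_I]
    have h1 := hF _ hz
    simp only [hpb] at h1
    have h2 : Filter.Tendsto (fun N => fejerMean N f t) Filter.atTop (nhds (f t)) :=
      ((continuous_eval_const (F := C(AddCircle (2 * Real.pi), ℂ)) (t : AddCircle (2 * Real.pi))).tendsto f).comp hfl
    exact tendsto_nhds_unique h1 h2
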